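/- Contracting the first upper index of 𝒫^{l+1} with the first lower index gives a multiple of 𝒫^l: Σ_{h=1}^D 𝒫^{l+1}{}^{h i_1…i_l}_{h j_1…j_l} = (1/(l+1))·[D + l − 2l/(D+2l−2)]·𝒫^l{}^{i_1…i_l}_{j_1…j_l} for all l ≥ 1 and all indices i_1,…,i_l, j_1,…,j_l ∈ {1,…,D}. -/

import Mathlib

open scoped BigOperators

noncomputable section
namespace Fuzzy

/-- Matrices acting on `ℂ^D ⊗ ℂ^D`, indexed by pairs. -/
abbrev PairMat (D : ℕ) := Matrix (Fin D × Fin D) (Fin D × Fin D) ℂ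

/-- The flip (permutation) operator `𝖯` on `ℂ^D ⊗ ℂ^D`: `𝖯^{hi}_{jk} = δ^h_k δ^i_j`. -/
def flipMat (D : ℕ) : PairMat D := fun p q => if p.1 = q.2 ∧ p.2 = q.1 then 1 else 0

/-- The trace projector `𝒫ᵗ`: `𝒫ᵗ{}^{hi}_{jk} = δ^{hi} δ_{jk} / D`. -/
def traceMat (D : ℕ) : PairMat D :=
  fun p q => (if p.1 = p.2 then 1 else 0) * (if q.1 = q.2 then 1 else 0) / (D : ℂ)

/-- The symmetric projector `𝒫⁺ = (1 + 𝖯)/2`. -/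
def symPlusMat (D : ℕ) : PairMat D := (2 : ℂ)⁻¹ • ((1 : PairMat D) + flipMat D)

/-- The antisymmetric projector `𝒫⁻ = (1 − 𝖯)/2`. -/
def symMinusMat (D : ℕ) : PairMat D := (2 : ℂ)⁻¹ • ((1 : PairMat D) - flipMat D)

/-- The trace-free symmetric projector `𝒫 = 𝒫⁺ − 𝒫ᵗ`. -/
def PsMat (D : ℕ) : PairMat D := symPlusMat D - traceMat D

/-- `𝒫′ = 𝒫⁻ + 𝒫ᵗ`. -/
def PprimeMat (D : ℕ) : PairMat D := symMinusMat D + traceMat D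

/-- Embedding of an operator on `ℂ^D ⊗ ℂ^D` acting on the tensor factors `n, n+1`
(0-based) of `(ℂ^D)^{⊗ l}`, and as the identity on the other factors. -/
def embAt (D l n : ℕ) (A : PairMat D) :
    Matrix (Fin l → Fin D) (Fin l → Fin D) ℂ := fun i j =>
  if h : n + 1 < l then
    A (i ⟨n, Nat.lt_of_succ_lt h⟩, i ⟨n + 1, h⟩) (j ⟨n, Nat.lt_of_succ_lt h⟩, j ⟨n + 1, h⟩) *
      ∏ m : Fin l, (if m.val = n ∨ m.val = n + 1 then 1 else if i m = j m then 1 else 0)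
  else 0

/-- Extension of an operator on `(ℂ^D)^{⊗ l}` to `(ℂ^D)^{⊗ (l+1)}`, acting as the
identity on the last tensor factor. -/
def extendLast (D l : ℕ) (A : Matrix (Fin l → Fin D) (Fin l → Fin D) ℂ) :
    Matrix (Fin (l + 1) → Fin D) (Fin (l + 1) → Fin D) ℂ := fun i j =>
  A (fun m => i m.castSucc) (fun m => j m.castSucc) *
    (if i (Fin.last l) = j (Fin.last l) then 1 else 0)

/-- Extension of an operator on `(ℂ^D)^{⊗ l}` to `(ℂ^D)^{⊗ (l+1)}`, acting as the
identity on the first tensor factor. -/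
def extendFirst (D l : ℕ) (A : Matrix (Fin l → Fin D) (Fin l → Fin D) ℂ) :
    Matrix (Fin (l + 1) → Fin D) (Fin (l + 1) → Fin D) ℂ := fun i j =>
  A (fun m => i m.succ) (fun m => j m.succ) * (if i 0 = j 0 then 1 else 0)

/-- The matrix `M(l+1) = (1/(l+1)) [1 + l·𝖯 − (2Dl/(D+2l−2))·𝒫ᵗ]`. -/
def MStep (D l : ℕ) : PairMat D :=
  ((l : ℂ) + 1)⁻¹ •
    ((1 : PairMat D) + (l : ℂ) • flipMat D -
      (2 * (D : ℂ) * (l : ℂ) / ((D : ℂ) + 2 * (l : ℂ) - 2)) • traceMat D)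

/-- The completely symmetric trace-free projector `𝒫^l` on `(ℂ^D)^{⊗ l}`, defined
recursively by `𝒫^1 = id`, `𝒫^{l+1} = 𝒫^l_{1…l} M(l+1)_{l(l+1)} 𝒫^l_{1…l}`. -/
def symProj (D : ℕ) : (l : ℕ) → Matrix (Fin l → Fin D) (Fin l → Fin D) ℂ
  | 0 => 1
  | 1 => 1
  | (l + 2) =>
      extendLast D (l + 1) (symProj D (l + 1)) * embAt D (l + 2) l (MStep D (l + 1)) *
        extendLast D (l + 1) (symProj D (l + 1))

end Fuzzy

namespace Fuzzy

/-- Appending an index at the end. -/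
def sn {D n : ℕ} (i : Fin n → Fin D) (a : Fin D) : Fin (n + 1) → Fin D :=
  Fin.snoc (α := fun _ => Fin D) i a

@[simp] lemma sn_castSucc {D n : ℕ} (i : Fin n → Fin D) (a : Fin D) (m : Fin n) :
    sn i a m.castSucc = i m := by simp [sn]

@[simp] lemma sn_last {D n : ℕ} (i : Fin n → Fin D) (a : Fin D) :
    sn i a (Fin.last n) = a := by simp [sn]

lemma exists_sn {D n : ℕ} (i : Fin (n + 1) → Fin D) : ∃ i' a, i = sn i' a :=
  ⟨fun m => i m.castSucc, i (Fin.last n), by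
    funext m
    refine Fin.lastCases ?_ (fun m => ?_) m <;> simp⟩

lemma sn_inj {D n : ℕ} {i j : Fin n → Fin D} {a b : Fin D} :
    sn i a = sn j b ↔ i = j ∧ a = b := by
  constructor
  · intro h
    refine ⟨funext fun m => ?_, ?_⟩
    · simpa using congrFun h m.castSucc
    · simpa using congrFun h (Fin.last n)
  · rintro ⟨rfl, rfl⟩; rfl

lemma sum_sn {D n : ℕ} (f : (Fin (n + 1) → Fin D) → ℂ) :
    ∑ i, f i = ∑ i : Fin n → Fin D, ∑ a, f (sn i a) := by
  rw [← (Fin.snocEquiv (fun _ : Fin (n + 1) => Fin D)).sum_comp, Fintype.sum_prod_type,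
    Finset.sum_comm]
  rfl

lemma extendLast_sn {D n : ℕ} (A : Matrix (Fin n → Fin D) (Fin n → Fin D) ℂ)
    (i j : Fin n → Fin D) (a b : Fin D) :
    extendLast D n A (sn i a) (sn j b) = A i j * if a = b then 1 else 0 := by
  simp [extendLast]

lemma extendLast_mul {D n : ℕ} (A B : Matrix (Fin n → Fin D) (Fin n → Fin D) ℂ) :
    extendLast D n (A * B) = extendLast D n A * extendLast D n B := by
  ext i j
  obtain ⟨i, a, rfl⟩ := exists_sn i
  obtain ⟨j, b, rfl⟩ := exists_sn j
  simp only [extendLast_sn, Matrix.mul_apply, sum_sn, Finset.sum_mul]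
  refine Finset.sum_congr rfl fun k _ => ?_
  by_cases h : a = b
  · subst h; simp
  · simp [h]

lemma extendLast_zero {D n : ℕ} : extendLast D n 0 = 0 := by
  ext i j; simp [extendLast]

lemma extendLast_transpose {D n : ℕ} (A : Matrix (Fin n → Fin D) (Fin n → Fin D) ℂ) :
    (extendLast D n A).transpose = extendLast D n A.transpose := by
  ext i j; simp [extendLast, eq_comm]

lemma extendLast_mulVec {D n : ℕ} (A : Matrix (Fin n → Fin D) (Fin n → Fin D) ℂ)
    (f : (Fin (n + 1) → Fin D) → ℂ) (i : Fin n → Fin D) (a : Fin D) :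
    (extendLast D n A).mulVec f (sn i a) = ∑ j, A i j * f (sn j a) := by
  simp [Matrix.mulVec, dotProduct, sum_sn, extendLast_sn]

lemma prod_delta {D n : ℕ} (i j : Fin n → Fin D) :
    (∏ m : Fin n, (if i m = j m then (1 : ℂ) else 0)) = if i = j then 1 else 0 := by
  rw [Finset.prod_ite_zero]
  simp [funext_iff]

lemma embAt_sn {D n : ℕ} (A : PairMat D) (i j : Fin n → Fin D) (a b c d : Fin D) :
    embAt D (n + 2) n A (sn (sn i a) b) (sn (sn j c) d) =
      A (a, b) (c, d) * if i = j then 1 else 0 := by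
  have h1 : (⟨n, by omega⟩ : Fin (n + 2)) = (Fin.last n).castSucc := rfl
  have h2 : (⟨n + 1, by omega⟩ : Fin (n + 2)) = Fin.last (n + 1) := rfl
  have h3 : ∀ x : Fin n, x.val ≠ n ∧ x.val ≠ n + 1 := fun x => by omega
  unfold embAt
  rw [dif_pos (by omega)]
  simp only [h1, h2, sn_castSucc, sn_last]
  congr 1
  rw [Fin.prod_univ_castSucc, Fin.prod_univ_castSucc]
  simp only [sn_castSucc, sn_last, Fin.val_castSucc, Fin.val_last, (h3 _).1, (h3 _).2]
  simp [prod_delta]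

lemma embAt_extend {D n : ℕ} (A : PairMat D) :
    embAt D (n + 3) n A = extendLast D (n + 2) (embAt D (n + 2) n A) := by
  ext i j
  unfold extendLast embAt
  rw [dif_pos (by omega), dif_pos (by omega), Fin.prod_univ_castSucc, mul_assoc]
  simp

lemma embAt_add {D l n : ℕ} (A B : PairMat D) :
    embAt D l n (A + B) = embAt D l n A + embAt D l n B := by
  ext i j
  simp only [embAt, Matrix.add_apply]
  split_ifs <;> ring

lemma embAt_smul {D l n : ℕ} (c : ℂ) (A : PairMat D) :
    embAt D l n (c • A) = c • embAt D l n A := by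
  ext i j
  simp only [embAt, Matrix.smul_apply, smul_eq_mul]
  split_ifs <;> ring

lemma embAt_one {D n : ℕ} : embAt D (n + 2) n 1 = 1 := by
  ext i j
  obtain ⟨i, b, rfl⟩ := exists_sn i
  obtain ⟨i, a, rfl⟩ := exists_sn i
  obtain ⟨j, d, rfl⟩ := exists_sn j
  obtain ⟨j, c, rfl⟩ := exists_sn j
  simp only [embAt_sn, Matrix.one_apply, sn_inj, Prod.mk.injEq]
  by_cases h : i = j <;> by_cases h2 : a = c <;> by_cases h3 : b = d <;> simp [h, h2, h3]

lemma embAt_transpose {D l n : ℕ} (A : PairMat D) :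
    (embAt D l n A).transpose = embAt D l n A.transpose := by
  ext i j; simp [embAt, eq_comm]

lemma embAt_mulVec {D n : ℕ} (A : PairMat D) (f : (Fin (n + 2) → Fin D) → ℂ)
    (i : Fin n → Fin D) (a b : Fin D) :
    (embAt D (n + 2) n A).mulVec f (sn (sn i a) b) =
      ∑ c, ∑ d, A (a, b) (c, d) * f (sn (sn i c) d) := by
  simp only [Matrix.mulVec, dotProduct, sum_sn, embAt_sn]
  rw [Finset.sum_eq_single i]
  · simp
  · intro j _ hj; simp [hj.symm]
  · simp

/-- Unnormalised trace projector. -/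
def kMat (D : ℕ) : PairMat D := (D : ℂ) • traceMat D

lemma kMat_apply {D : ℕ} (hD : 2 ≤ D) (a b c d : Fin D) :
    kMat D (a, b) (c, d) = (if a = b then 1 else 0) * if c = d then 1 else 0 := by
  have : (D : ℂ) ≠ 0 := by norm_cast; omega
  simp only [kMat, traceMat, Matrix.smul_apply, smul_eq_mul]
  field_simp

/-- flip on the last two factors -/
def SS (D n : ℕ) := embAt D (n + 2) n (flipMat D)
/-- trace on the last two factors -/
def KK (D n : ℕ) := embAt D (n + 2) n (kMat D)

lemma SS_mulVec {D n : ℕ} (f : (Fin (n + 2) → Fin D) → ℂ) (i : Fin n → Fin D) (a b : Fin D) :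
    (SS D n).mulVec f (sn (sn i a) b) = f (sn (sn i b) a) := by
  rw [SS, embAt_mulVec]
  simp [flipMat, ite_and]

lemma KK_mulVec {D n : ℕ} (hD : 2 ≤ D) (f : (Fin (n + 2) → Fin D) → ℂ) (i : Fin n → Fin D)
    (a b : Fin D) :
    (KK D n).mulVec f (sn (sn i a) b) = if a = b then ∑ h, f (sn (sn i h) h) else 0 := by
  rw [KK, embAt_mulVec]
  simp [kMat_apply hD]

lemma sS_mulVec {D n : ℕ} (f : (Fin (n + 3) → Fin D) → ℂ) (i : Fin n → Fin D) (a b c : Fin D) :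
    (extendLast D (n + 2) (SS D n)).mulVec f (sn (sn (sn i a) b) c)
      = f (sn (sn (sn i b) a) c) := by
  rw [extendLast_mulVec]
  exact SS_mulVec (fun j => f (sn j c)) i a b

lemma kK_mulVec {D n : ℕ} (hD : 2 ≤ D) (f : (Fin (n + 3) → Fin D) → ℂ) (i : Fin n → Fin D)
    (a b c : Fin D) :
    (extendLast D (n + 2) (KK D n)).mulVec f (sn (sn (sn i a) b) c)
      = if a = b then ∑ h, f (sn (sn (sn i h) h) c) else 0 := by
  rw [extendLast_mulVec]
  exact KK_mulVec hD (fun j => f (sn j c)) i a b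

lemma mat_ext2 {D n : ℕ} {A B : Matrix (Fin (n + 2) → Fin D) (Fin (n + 2) → Fin D) ℂ}
    (h : ∀ f i a b, A.mulVec f (sn (sn i a) b) = B.mulVec f (sn (sn i a) b)) : A = B := by
  apply Matrix.mulVec_injective
  funext f x
  obtain ⟨x, c, rfl⟩ := exists_sn x
  obtain ⟨x, b, rfl⟩ := exists_sn x
  exact h f x b c

lemma mat_ext3 {D n : ℕ} {A B : Matrix (Fin (n + 3) → Fin D) (Fin (n + 3) → Fin D) ℂ}
    (h : ∀ f i a b c, A.mulVec f (sn (sn (sn i a) b) c) = B.mulVec f (sn (sn (sn i a) b) c)) :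
    A = B := by
  apply mat_ext2
  intro f x b c
  obtain ⟨x, a, rfl⟩ := exists_sn x
  exact h f x a b c

section rel
variable {D n : ℕ}

lemma rel_SS : SS D n * SS D n = 1 := by
  apply mat_ext2; intro f i a b
  simp [← Matrix.mulVec_mulVec, SS_mulVec]

lemma rel_KS (hD : 2 ≤ D) : KK D n * SS D n = KK D n := by
  apply mat_ext2; intro f i a b
  simp [← Matrix.mulVec_mulVec, SS_mulVec, KK_mulVec hD]

lemma rel_SK (hD : 2 ≤ D) : SS D n * KK D n = KK D n := by
  apply mat_ext2; intro f i a b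
  simp [← Matrix.mulVec_mulVec, SS_mulVec, KK_mulVec hD, eq_comm]

lemma rel_KK (hD : 2 ≤ D) : KK D n * KK D n = (D : ℂ) • KK D n := by
  apply mat_ext2; intro f i a b
  simp [← Matrix.mulVec_mulVec, KK_mulVec hD, Matrix.smul_mulVec]

lemma rel_KsS (hD : 2 ≤ D) :
    KK D (n + 1) * extendLast D (n + 2) (SS D n) * SS D (n + 1)
      = KK D (n + 1) * extendLast D (n + 2) (KK D n) := by
  apply mat_ext3; intro f i a b c
  simp [← Matrix.mulVec_mulVec, SS_mulVec, sS_mulVec, KK_mulVec hD, kK_mulVec hD]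

lemma rel_KkS (hD : 2 ≤ D) :
    KK D (n + 1) * extendLast D (n + 2) (KK D n) * SS D (n + 1)
      = KK D (n + 1) * extendLast D (n + 2) (SS D n) := by
  apply mat_ext3; intro f i a b c
  simp [← Matrix.mulVec_mulVec, SS_mulVec, sS_mulVec, KK_mulVec hD, kK_mulVec hD]

lemma rel_KsK (hD : 2 ≤ D) :
    KK D (n + 1) * extendLast D (n + 2) (SS D n) * KK D (n + 1) = KK D (n + 1) := by
  apply mat_ext3; intro f i a b c
  simp [← Matrix.mulVec_mulVec, SS_mulVec, sS_mulVec, KK_mulVec hD, kK_mulVec hD]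

lemma rel_KkK (hD : 2 ≤ D) :
    KK D (n + 1) * extendLast D (n + 2) (KK D n) * KK D (n + 1) = KK D (n + 1) := by
  apply mat_ext3; intro f i a b c
  simp [← Matrix.mulVec_mulVec, SS_mulVec, sS_mulVec, KK_mulVec hD, kK_mulVec hD]

lemma rel_SsS :
    SS D (n + 1) * extendLast D (n + 2) (SS D n) * SS D (n + 1)
      = extendLast D (n + 2) (SS D n) * SS D (n + 1) * extendLast D (n + 2) (SS D n) := by
  apply mat_ext3; intro f i a b c
  simp [← Matrix.mulVec_mulVec, SS_mulVec, sS_mulVec]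

lemma rel_SkS (hD : 2 ≤ D) :
    SS D (n + 1) * extendLast D (n + 2) (KK D n) * SS D (n + 1)
      = extendLast D (n + 2) (SS D n) * KK D (n + 1) * extendLast D (n + 2) (SS D n) := by
  apply mat_ext3; intro f i a b c
  simp [← Matrix.mulVec_mulVec, SS_mulVec, sS_mulVec, KK_mulVec hD, kK_mulVec hD]

lemma rel_kSs (hD : 2 ≤ D) :
    extendLast D (n + 2) (KK D n) * SS D (n + 1) * extendLast D (n + 2) (SS D n)
      = extendLast D (n + 2) (KK D n) * KK D (n + 1) := by
  apply mat_ext3; intro f i a b c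
  simp [← Matrix.mulVec_mulVec, SS_mulVec, sS_mulVec, KK_mulVec hD, kK_mulVec hD]

lemma rel_SsK (hD : 2 ≤ D) :
    SS D (n + 1) * extendLast D (n + 2) (SS D n) * KK D (n + 1)
      = extendLast D (n + 2) (KK D n) * KK D (n + 1) := by
  apply mat_ext3; intro f i a b c
  simp [← Matrix.mulVec_mulVec, SS_mulVec, sS_mulVec, KK_mulVec hD, kK_mulVec hD]

lemma rel_SkK (hD : 2 ≤ D) :
    SS D (n + 1) * extendLast D (n + 2) (KK D n) * KK D (n + 1)
      = extendLast D (n + 2) (SS D n) * KK D (n + 1) := by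
  apply mat_ext3; intro f i a b c
  simp [← Matrix.mulVec_mulVec, SS_mulVec, sS_mulVec, KK_mulVec hD, kK_mulVec hD]

lemma rel_comm (A : PairMat D) (q : Matrix (Fin n → Fin D) (Fin n → Fin D) ℂ) :
    embAt D (n + 2) n A * extendLast D (n + 1) (extendLast D n q)
      = extendLast D (n + 1) (extendLast D n q) * embAt D (n + 2) n A := by
  have key : ∀ f i a b, (extendLast D (n + 1) (extendLast D n q)).mulVec f (sn (sn i a) b)
      = ∑ j, q i j * f (sn (sn j a) b) := by
    intro f i a b
    rw [extendLast_mulVec]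
    exact extendLast_mulVec q (fun j => f (sn j b)) i a
  apply mat_ext2; intro f i a b
  simp only [← Matrix.mulVec_mulVec, key, embAt_mulVec, Finset.mul_sum]
  rw [Finset.sum_comm]
  conv_rhs => rw [Finset.sum_comm' (t' := Finset.univ) (s' := fun _ => Finset.univ) (by simp)]
  rw [Finset.sum_comm]
  refine Finset.sum_congr rfl fun c _ => ?_
  rw [Finset.sum_comm]
  refine Finset.sum_congr rfl fun d _ => Finset.sum_congr rfl fun e _ => ?_
  ring
end rel

section abstractStep
variable {R : Type*} [Ring R] [Algebra ℂ R]

lemma abs_expand (q s k p : R) (c a b : ℂ)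
    (hp : p = c • (q * (1 + a • s - b • k) * q)) (hqp : q * p = p) (X Y : R)
    (hX : X * q = q * X) (hY : Y * q = q * Y) :
    Y * p * X * p = c • (q * (Y * X * p) + a • (q * (Y * s * X * p)) - b • (q * (Y * k * X * p)))
    := by
  calc Y * p * X * p = Y * (c • (q * (1 + a • s - b • k) * q)) * X * p := by rw [← hp]
    _ = c • ((Y * q) * (1 + a • s - b • k) * (q * X) * p) := by
        simp only [mul_smul_comm, smul_mul_assoc, mul_assoc]
    _ = c • (q * Y * (1 + a • s - b • k) * X * (q * p)) := by
        rw [hY, ← hX]; simp only [mul_assoc]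
    _ = _ := by
        rw [hqp]
        simp only [mul_add, add_mul, mul_sub, sub_mul, mul_smul_comm, smul_mul_assoc, mul_assoc,
          one_mul]

lemma abs_step (q s k S K p : R) (c a b d be L : ℂ)
    (hp : p = c • (q * (1 + a • s - b • k) * q)) (hqp : q * p = p) (hpp : p * p = p)
    (hsp : s * p = p) (hkp : k * p = 0)
    (hSq : S * q = q * S) (hKq : K * q = q * K)
    (rSS : S * S = 1) (rKS : K * S = K) (rSK : S * K = K) (rKK : K * K = d • K)
    (rKsS : K * s * S = K * k) (rKkS : K * k * S = K * s) (rKsK : K * s * K = K)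
    (rKkK : K * k * K = K) (rSsS : S * s * S = s * S * s) (rSkS : S * k * S = s * K * s)
    (rkSs : k * S * s = k * K) (rSsK : S * s * K = k * K) (rSkK : S * k * K = s * K)
    (hLc : L * c = 1) (hb : b = be * (a + b)) (hz : 2 - b = be * (d + a - b)) :
    S * (p * (1 + L • S - (be * L) • K) * p) = p * (1 + L • S - (be * L) • K) * p ∧
    K * (p * (1 + L • S - (be * L) • K) * p) = 0 := by
  have hkSp : k * S * p = k * K * p := by
    calc k * S * p = k * S * s * p := by rw [mul_assoc (k * S), hsp]
      _ = _ := by rw [rkSs]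
  have qS : q * (S * p) = S * p := by rw [← mul_assoc, ← hSq, mul_assoc, hqp]
  have qK : q * (K * p) = K * p := by rw [← mul_assoc, ← hKq, mul_assoc, hqp]
  have h1q : (1 : R) * q = q * 1 := by simp
  have e1 := abs_expand q s k p c a b hp hqp S K hSq hKq
  have e2 := abs_expand q s k p c a b hp hqp K K hKq hKq
  have e3 := abs_expand q s k p c a b hp hqp S S hSq hSq
  have e4 := abs_expand q s k p c a b hp hqp K S hKq hSq
  have e5 := abs_expand q s k p c a b hp hqp S 1 hSq h1q
  have e6 := abs_expand q s k p c a b hp hqp K 1 hKq h1q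
  rw [rKS, rKsS, rKkS, mul_assoc K k p, mul_assoc K s p, hkp, hsp, mul_zero, mul_zero, qK] at e1
  rw [rKK, rKsK, rKkK, smul_mul_assoc, mul_smul_comm, qK] at e2
  rw [rSS, rSsS, rSkS, mul_assoc (s * S) s p, mul_assoc (s * K) s p, hsp, one_mul, hqp] at e3
  rw [rSK, rSsK, rSkK, qK] at e4
  simp only [one_mul] at e5 e6
  rw [qS, hkSp] at e5
  rw [qK] at e6
  have ex : p * (1 + L • S - (be * L) • K) * p = p + L • (p * S * p) - (be * L) • (p * K * p) := by
    simp only [mul_add, add_mul, mul_sub, sub_mul, mul_smul_comm, smul_mul_assoc, mul_one, hpp]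
  have ex' : ∀ Y : R, Y * (p * (1 + L • S - (be * L) • K) * p)
      = Y * p + L • (Y * p * S * p) - (be * L) • (Y * p * K * p) := by
    intro Y
    rw [ex]
    simp only [mul_add, mul_sub, mul_smul_comm, mul_assoc]
  constructor
  · rw [ex', ex, e3, e4, e5, e6]
    match_scalars <;> grind
  · rw [ex', e1, e2]
    match_scalars
    grind

end abstractStep

lemma embAt_MStep (D n l : ℕ) : embAt D (n + 2) n (MStep D l) =
    ((l : ℂ) + 1)⁻¹ • (1 + (l : ℂ) • SS D n
      - ((2 / ((D : ℂ) + 2 * (l : ℂ) - 2)) * l) • KK D n) := by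
  have : MStep D l = ((l : ℂ) + 1)⁻¹ • (1 + (l : ℂ) • flipMat D
      + (-((2 / ((D : ℂ) + 2 * (l : ℂ) - 2)) * l)) • kMat D) := by
    unfold MStep kMat
    module
  rw [this]
  simp only [embAt_smul, embAt_add, embAt_one]
  rw [← SS, ← KK]
  module

lemma symProj_succ (D n : ℕ) : symProj D (n + 2) =
    extendLast D (n + 1) (symProj D (n + 1)) * embAt D (n + 2) n (MStep D (n + 1)) *
        extendLast D (n + 1) (symProj D (n + 1)) := rfl

lemma extendLast_one {D n : ℕ} : extendLast D n 1 = 1 := by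
  ext i j
  obtain ⟨i, a, rfl⟩ := exists_sn i
  obtain ⟨j, b, rfl⟩ := exists_sn j
  simp only [extendLast_sn, Matrix.one_apply, sn_inj]
  by_cases h : i = j <;> by_cases h2 : a = b <;> simp [h, h2]

lemma symProj_two (D : ℕ) : symProj D 2 = embAt D 2 0 (MStep D 1) := by
  rw [symProj_succ D 0]
  simp only [Nat.zero_add]
  rw [show symProj D 1 = 1 from rfl, extendLast_one]
  simp

/-- idempotency from the two annihilation properties -/
lemma idem_of (D n : ℕ) (h1 : symProj D (n + 1) * symProj D (n + 1) = symProj D (n + 1))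
    (hS : SS D n * symProj D (n + 2) = symProj D (n + 2))
    (hK : KK D n * symProj D (n + 2) = 0) :
    symProj D (n + 2) * symProj D (n + 2) = symProj D (n + 2) := by
  set p := extendLast D (n + 1) (symProj D (n + 1)) with hp
  have hpp : p * p = p := by rw [hp, ← extendLast_mul, h1]
  have hpP : p * symProj D (n + 2) = symProj D (n + 2) := by
    rw [symProj_succ, ← hp, ← mul_assoc, ← mul_assoc, hpp]
  have hM : embAt D (n + 2) n (MStep D (n + 1)) * symProj D (n + 2) = symProj D (n + 2) := by
    rw [embAt_MStep, smul_mul_assoc, sub_mul, add_mul, smul_mul_assoc, smul_mul_assoc, hS, hK,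
      one_mul, smul_zero, sub_zero]
    have : (n : ℂ) + 1 + 1 ≠ 0 := by norm_cast
    match_scalars
    push_cast
    field_simp
    ring
  calc symProj D (n + 2) * symProj D (n + 2)
      = p * (embAt D (n + 2) n (MStep D (n + 1)) * (p * symProj D (n + 2))) := by
        conv_lhs => enter [1]; rw [symProj_succ, ← hp]
        simp only [mul_assoc]
    _ = symProj D (n + 2) := by rw [hpP, hM, hpP]

lemma main_inv (D : ℕ) (hD : 2 ≤ D) (n : ℕ) :
    symProj D (n + 1) * symProj D (n + 1) = symProj D (n + 1) ∧
    SS D n * symProj D (n + 2) = symProj D (n + 2) ∧ KK D n * symProj D (n + 2) = 0 := by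
  have hD0 : (D : ℂ) ≠ 0 := by norm_cast; omega
  induction n with
  | zero =>
    refine ⟨by rw [show symProj D (0 + 1) = 1 from rfl, one_mul], ?_, ?_⟩
    · rw [symProj_two, embAt_MStep, mul_smul_comm, mul_sub, mul_add, mul_smul_comm, mul_smul_comm,
        rel_SS, rel_SK hD]
      simp only [mul_one, Nat.cast_one]
      module
    · rw [symProj_two, embAt_MStep, mul_smul_comm, mul_sub, mul_add, mul_smul_comm, mul_smul_comm,
        rel_KS hD, rel_KK hD]
      simp only [mul_one, Nat.cast_one]
      have hz : (D : ℂ) + 2 - 2 = D := by ring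
      match_scalars
      rw [mul_one, hz]
      field_simp
      ring
  | succ n ih =>
    obtain ⟨h1, hS, hK⟩ := ih
    have h2 := idem_of D n h1 hS hK
    refine ⟨h2, ?_⟩
    have hn1 : (n : ℂ) + 2 ≠ 0 := by norm_cast
    have hn2 : (D : ℂ) + 2 * n ≠ 0 := by norm_cast; omega
    have hn3 : (D : ℂ) + 2 * n + 2 ≠ 0 := by norm_cast
    have hn2' : (D : ℂ) + 2 * (n + 1) - 2 ≠ 0 := by convert hn2 using 1; ring
    have hn3' : (D : ℂ) + 2 * (n + 2) - 2 ≠ 0 := by convert hn3 using 1; ring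
    have key := abs_step (extendLast D (n + 2) (extendLast D (n + 1) (symProj D (n + 1))))
      (extendLast D (n + 2) (SS D n)) (extendLast D (n + 2) (KK D n))
      (SS D (n + 1)) (KK D (n + 1)) (extendLast D (n + 2) (symProj D (n + 2)))
      ((n : ℂ) + 2)⁻¹ ((n : ℂ) + 1) ((2 / ((D : ℂ) + 2 * (n + 1) - 2)) * (n + 1)) D
      (2 / ((D : ℂ) + 2 * (n + 2) - 2)) (n + 2)
      (by
        have e : embAt D (n + 3) n (MStep D (n + 1)) = _ := embAt_extend _
        rw [symProj_succ, extendLast_mul, extendLast_mul, embAt_MStep]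
        have lin : ∀ (c a b : ℂ) (A B : Matrix (Fin (n + 2) → Fin D) (Fin (n + 2) → Fin D) ℂ),
            extendLast D (n + 2) (c • (1 + a • A - b • B))
              = c • (1 + a • extendLast D (n + 2) A - b • extendLast D (n + 2) B) := by
          intro c a b A B
          have h1 : (1 : Matrix (Fin (n + 2 + 1) → Fin D) (Fin (n + 2 + 1) → Fin D) ℂ)
              = extendLast D (n + 2) 1 := extendLast_one.symm
          rw [h1]
          ext i j
          simp only [extendLast, Matrix.smul_apply, Matrix.sub_apply, Matrix.add_apply,
            smul_eq_mul]
          ring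
        rw [lin]
        push_cast
        rw [mul_smul_comm, smul_mul_assoc, show (n : ℂ) + 1 + 1 = n + 2 by ring])
      (by
        rw [← extendLast_mul]; congr 1
        rw [symProj_succ, ← mul_assoc, ← mul_assoc, ← extendLast_mul, h1])
      (by rw [← extendLast_mul, h2])
      (by rw [← extendLast_mul, hS])
      (by rw [← extendLast_mul, hK, extendLast_zero])
      (rel_comm _ _) (rel_comm _ _) rel_SS (rel_KS hD) (rel_SK hD) (rel_KK hD)
      (rel_KsS hD) (rel_KkS hD) (rel_KsK hD) (rel_KkK hD) rel_SsS (rel_SkS hD) (rel_kSs hD)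
      (rel_SsK hD) (rel_SkK hD)
      (by field_simp)
      (by field_simp; ring)
      (by field_simp; ring)
    have e : symProj D (n + 1 + 2) = ((n : ℂ) + 3)⁻¹ •
        (extendLast D (n + 2) (symProj D (n + 2)) *
        (1 + ((n : ℂ) + 2) • SS D (n + 1) - (2 / ((D : ℂ) + 2 * (n + 2) - 2) * (n + 2)) •
          KK D (n + 1)) * extendLast D (n + 2) (symProj D (n + 2))) := by
      rw [symProj_succ, embAt_MStep]
      push_cast
      rw [mul_smul_comm, smul_mul_assoc, show (n : ℂ) + 1 + 1 = n + 2 by ring,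
        show (n : ℂ) + 2 + 1 = n + 3 by ring]
    rw [e, mul_smul_comm, mul_smul_comm, key.1, key.2]
    simp

lemma symProj_idem (D : ℕ) (hD : 2 ≤ D) (n : ℕ) :
    symProj D (n + 1) * symProj D (n + 1) = symProj D (n + 1) := (main_inv D hD n).1

lemma MStep_transpose (D l : ℕ) : (MStep D l).transpose = MStep D l := by
  have h1 : (flipMat D).transpose = flipMat D := by
    ext ⟨a, b⟩ ⟨c, d⟩
    simp only [flipMat, Matrix.transpose_apply]
    congr 1
    grind
  have h2 : (traceMat D).transpose = traceMat D := by
    ext ⟨a, b⟩ ⟨c, d⟩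
    simp only [traceMat, Matrix.transpose_apply]
    ring
  simp [MStep, Matrix.transpose_add, Matrix.transpose_sub, Matrix.transpose_smul, h1, h2]

lemma symProj_transpose (D n : ℕ) : (symProj D n).transpose = symProj D n := by
  induction n with
  | zero => exact Matrix.transpose_one
  | succ n ih =>
    cases n with
    | zero => exact Matrix.transpose_one
    | succ n =>
      rw [symProj_succ, Matrix.transpose_mul, Matrix.transpose_mul, extendLast_transpose, ih,
        embAt_transpose, MStep_transpose, mul_assoc]

lemma swap_inv (D : ℕ) (hD : 2 ≤ D) (n : ℕ) (m : Fin n) (i j : Fin (n + 1) → Fin D) :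
    symProj D (n + 1) (i ∘ Equiv.swap m.castSucc m.succ) j = symProj D (n + 1) i j := by
  induction n with
  | zero => exact m.elim0
  | succ n ih =>
    obtain ⟨i, b, rfl⟩ := exists_sn i
    refine Fin.lastCases ?_ (fun m => ?_) m
    · obtain ⟨i, a, rfl⟩ := exists_sn i
      have h := congrFun (congrFun (main_inv D hD n).2.1 (sn (sn i a) b)) j
      have h' := SS_mulVec (fun x => symProj D (n + 2) x j) i a b
      have h'' : sn (sn i a) b ∘ Equiv.swap (Fin.last n).castSucc (Fin.last n).succ
          = sn (sn i b) a := by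
        funext x
        refine Fin.lastCases ?_ (fun x => ?_) x
        · simp [Fin.succ_last, Equiv.swap_apply_right]
        · refine Fin.lastCases ?_ (fun x => ?_) x
          · simp [Fin.succ_last]
          · rw [Function.comp, Equiv.swap_apply_of_ne_of_ne]
            · simp
            · simp [Fin.ext_iff]; omega
            · simp [Fin.ext_iff]; omega
      rw [h'', ← h', ← h]
      rfl
    · have h'' : sn i b ∘ Equiv.swap m.castSucc.castSucc m.castSucc.succ
          = sn (i ∘ Equiv.swap m.castSucc m.succ) b := by
        funext x
        refine Fin.lastCases ?_ (fun x => ?_) x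
        · rw [Function.comp, Equiv.swap_apply_of_ne_of_ne]
          · simp
          · simp [Fin.ext_iff]; omega
          · simp [Fin.ext_iff]; omega
        · simp only [Function.comp, sn_castSucc, Fin.succ_castSucc]
          rw [(Fin.castSucc_injective _).swap_apply, sn_castSucc]
      rw [h'', symProj_succ, mul_assoc]
      rw [Matrix.mul_apply, Matrix.mul_apply]
      refine Finset.sum_congr rfl fun x _ => ?_
      obtain ⟨x, c, rfl⟩ := exists_sn x
      rw [extendLast_sn, extendLast_sn, ih]

lemma perm_inv (D : ℕ) (hD : 2 ≤ D) (n : ℕ) (σ : Equiv.Perm (Fin (n + 1)))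
    (i j : Fin (n + 1) → Fin D) :
    symProj D (n + 1) (i ∘ σ) j = symProj D (n + 1) i j := by
  have hσ : σ ∈ Submonoid.closure
      (Set.range fun m : Fin n => Equiv.swap m.castSucc m.succ) := by
    rw [Equiv.Perm.mclosure_swap_castSucc_succ]; trivial
  induction hσ using Submonoid.closure_induction generalizing i with
  | mem x hx => obtain ⟨m, rfl⟩ := hx; exact swap_inv D hD n m i j
  | one => rfl
  | mul x y _ _ hx hy =>
    rw [Equiv.Perm.coe_mul, ← Function.comp_assoc, hy, hx]

lemma perm_inv2 (D : ℕ) (hD : 2 ≤ D) (n : ℕ) (σ : Equiv.Perm (Fin (n + 1)))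
    (i j : Fin (n + 1) → Fin D) :
    symProj D (n + 1) (i ∘ σ) (j ∘ σ) = symProj D (n + 1) i j := by
  rw [perm_inv D hD]
  have h : ∀ x y, symProj D (n + 1) x y = symProj D (n + 1) y x := fun x y =>
    congrFun (congrFun (symProj_transpose D (n + 1)) y) x
  rw [h, perm_inv D hD, h]

lemma cons_eq_sn (D : ℕ) (hD : 2 ≤ D) (n : ℕ) (h : Fin D) (i j : Fin n → Fin D) :
    symProj D (n + 1) (Fin.cons h i) (Fin.cons h j) = symProj D (n + 1) (sn i h) (sn j h) := by
  have key : ∀ i : Fin n → Fin D,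
      (Fin.cons h i : Fin (n + 1) → Fin D) ∘ finRotate (n + 1) = sn i h := by
    intro i
    funext x
    refine Fin.lastCases ?_ (fun x => ?_) x
    · simp
    · simp [Fin.coeSucc_eq_succ]
  rw [← key, ← key, perm_inv2 D hD]

lemma ptrace_M (D : ℕ) (hD : 2 ≤ D) (l : ℕ) (a b : Fin D) :
    ∑ h, MStep D l (a, h) (b, h) = ((l : ℂ) + 1)⁻¹ *
      ((D : ℂ) + (l : ℂ) - 2 * (l : ℂ) / ((D : ℂ) + 2 * (l : ℂ) - 2)) *
        if a = b then 1 else 0 := by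
  have hD0 : (D : ℂ) ≠ 0 := by norm_cast; omega
  have s1 : ∑ h : Fin D, (1 : PairMat D) (a, h) (b, h) = D * if a = b then 1 else 0 := by
    simp [Matrix.one_apply]
  have s2 : ∑ h : Fin D, flipMat D (a, h) (b, h) = if a = b then 1 else 0 := by
    simp [flipMat, ite_and]
  have s3 : ∑ h : Fin D, traceMat D (a, h) (b, h) = (if a = b then 1 else 0) / D := by
    simp [traceMat, ← Finset.sum_div, eq_comm]
  simp only [MStep, Matrix.smul_apply, Matrix.sub_apply, Matrix.add_apply, smul_eq_mul,
    ← Finset.mul_sum, Finset.sum_sub_distrib, Finset.sum_add_distrib, s1, s2, s3]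
  field_simp

lemma ptrace_emb (D : ℕ) (hD : 2 ≤ D) (n l : ℕ) (i j : Fin (n + 1) → Fin D) :
    ∑ h, embAt D (n + 2) n (MStep D l) (sn i h) (sn j h) = ((l : ℂ) + 1)⁻¹ *
      ((D : ℂ) + (l : ℂ) - 2 * (l : ℂ) / ((D : ℂ) + 2 * (l : ℂ) - 2)) *
        (1 : Matrix (Fin (n + 1) → Fin D) (Fin (n + 1) → Fin D) ℂ) i j := by
  obtain ⟨i, a, rfl⟩ := exists_sn i
  obtain ⟨j, b, rfl⟩ := exists_sn j
  simp only [embAt_sn, ← Finset.sum_mul, ptrace_M D hD, Matrix.one_apply, sn_inj]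
  by_cases h : i = j <;> by_cases h2 : a = b <;> simp [h, h2]

lemma ptrace_mul {D n : ℕ} (A C : Matrix (Fin n → Fin D) (Fin n → Fin D) ℂ)
    (B : Matrix (Fin (n + 1) → Fin D) (Fin (n + 1) → Fin D) ℂ) (i j : Fin n → Fin D) :
    ∑ h, (extendLast D n A * B * extendLast D n C) (sn i h) (sn j h) =
      (A * (Matrix.of fun x y => ∑ h, B (sn x h) (sn y h)) * C) i j := by
  simp only [Matrix.mul_apply, sum_sn, extendLast_sn, Matrix.of_apply]
  simp only [mul_ite, mul_one, mul_zero, ite_mul, zero_mul, Finset.sum_ite_eq, Finset.sum_ite_eq',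
    Finset.mem_univ, if_true]
  rw [Finset.sum_comm]
  refine Finset.sum_congr rfl fun x _ => ?_
  rw [← Finset.sum_mul, Finset.sum_comm]
  simp only [Finset.mul_sum]

/-- Contraction of the first upper with the first lower index of
`𝒫^{l+1}` yields `(1/(l+1))·[D + l − 2l/(D+2l−2)]` times `𝒫^l`. -/
theorem statement2 (D : ℕ) (hD : 2 ≤ D) (l : ℕ) (hl : 1 ≤ l)
    (i j : Fin l → Fin D) :
    ∑ h : Fin D, symProj D (l + 1) (Fin.cons h i) (Fin.cons h j) =
      ((l : ℂ) + 1)⁻¹ * ((D : ℂ) + (l : ℂ) - 2 * (l : ℂ) / ((D : ℂ) + 2 * (l : ℂ) - 2)) *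
        symProj D l i j := by
  obtain ⟨n, rfl⟩ : ∃ n, l = n + 1 := ⟨l - 1, by omega⟩
  simp only [cons_eq_sn D hD]
  rw [symProj_succ, ptrace_mul]
  have h : (Matrix.of fun x y => ∑ h, embAt D (n + 2) n (MStep D (n + 1)) (sn x h) (sn y h)) =
      ((((n + 1 : ℕ) : ℂ) + 1)⁻¹ * ((D : ℂ) + ((n + 1 : ℕ) : ℂ) -
        2 * ((n + 1 : ℕ) : ℂ) / ((D : ℂ) + 2 * ((n + 1 : ℕ) : ℂ) - 2))) •
      (1 : Matrix (Fin (n + 1) → Fin D) (Fin (n + 1) → Fin D) ℂ) := by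
    ext x y
    rw [Matrix.of_apply, ptrace_emb D hD]
    rfl
  rw [h, mul_smul_comm, smul_mul_assoc, mul_one, symProj_idem D hD]
  rfl

end Fuzzy
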